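/- Consider the QCQP data n, m ∈ ℕ with n ≥ 1, vectors a⁰, a¹, …, aᵐ ∈ ℝⁿ, c^{x,0}, …, c^{x,m} ∈ ℝⁿ, c^{y,0}, …, c^{y,m} ∈ ℝⁿ, and b ∈ ℝᵐ. Let F_Mc be the set of tuples (x, y, u, w) ∈ ℝⁿ × ℝⁿ × ℝ^{2n} × ℝ^{2n×2n} such that: x_i = u_i and y_i = u_{n+i} for all i ∈ [n]; u ∈ [0,1]^{2n}; max{u_i + u_k − 1, 0} ≤ w_{ik} ≤ min{u_i, u_k} for all (i,k) ∈ [2n] × [2n]; and ∑_{i∈[n]} a^j_i w_{i, n+i} + ∑_{i∈[n]} c^{x,j}_i x_i + ∑_{i∈[n]} c^{y,j}_i y_i ≥ b_j for all j ∈ [m]. Let F_MS be the subset of F_Mc consisting of tuples for which additionally the (2n+1) × (2n+1) block matrix W = [[1, uᵀ],[u, w]] is positive semidefinite. Let f(x,y,u,w) = ∑_{i∈[n]} a⁰_i w_{i,n+i} + ∑_{i∈[n]} c^{x,0}_i x_i + ∑_{i∈[n]} c^{y,0}_i y_i. Then F_Mc is nonempty if and only if F_MS is nonempty, and the infimum of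 f over F_Mc equals the infimum of f over F_MS. -/

import Mathlib

/-- The second-moment matrix with independent pairs: means `x`, `y` of `{0,1}`-valued variables,
and `z i` the mixed moment of the `i`-th pair. -/
def pairedMoment {n : ℕ} (x y z : Fin n → ℝ) : Matrix (Fin n ⊕ Fin n) (Fin n ⊕ Fin n) ℝ
  | Sum.inl i, Sum.inl j => x i * x j + if i = j then x i - x i * x i else 0
  | Sum.inl i, Sum.inr j => x i * y j + if i = j then z i - x i * y i else 0
  | Sum.inr i, Sum.inl j => y i * x j + if i = j then z i - x i * y i else 0
  | Sum.inr i, Sum.inr j => y i * y j + if i = j then y i - y i * y i else 0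

/-- The variance of `s A + t B` for events `A`, `B` with probabilities `x`, `y` and
`P (A ∩ B) = z` is nonnegative. -/
lemma variance_pair_nonneg {x y z : ℝ} (hz : 0 ≤ z) (hx : z ≤ x) (hy : z ≤ y)
    (hxy : x + y - 1 ≤ z) (s t : ℝ) :
    0 ≤ (x - x * x) * (s * s) + 2 * (z - x * y) * (s * t) + (y - y * y) * (t * t) := by
  have h₁ := mul_nonneg hz (sq_nonneg (s + t - (x * s + y * t)))
  have h₂ := mul_nonneg (sub_nonneg.2 hx) (sq_nonneg (s - (x * s + y * t)))
  have h₃ := mul_nonneg (sub_nonneg.2 hy) (sq_nonneg (t - (x * s + y * t)))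
  have h₄ := mul_nonneg (sub_nonneg.2 hxy) (sq_nonneg (x * s + y * t))
  linarith

lemma sum_mul_add_ite {n : ℕ} (s t p q c : Fin n → ℝ) :
    ∑ i, s i * ∑ j, (p i * q j + if i = j then c i else 0) * t j =
      (∑ i, p i * s i) * (∑ j, q j * t j) + ∑ i, c i * (s i * t i) := by
  simp only [add_mul, ite_mul, zero_mul, Finset.sum_add_distrib, Finset.sum_ite_eq,
    Finset.mem_univ, if_true, mul_add]
  congr 1
  · rw [Finset.sum_mul]
    refine Finset.sum_congr rfl fun i _ => ?_
    simp only [mul_assoc, ← Finset.mul_sum]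
    ring
  · exact Finset.sum_congr rfl fun i _ => by ring

lemma posSemidef_pairedMoment {n : ℕ} (u : Fin n ⊕ Fin n → ℝ) (z : Fin n → ℝ)
    (hz : ∀ i, 0 ≤ z i) (hx : ∀ i, z i ≤ u (Sum.inl i)) (hy : ∀ i, z i ≤ u (Sum.inr i))
    (hxy : ∀ i, u (Sum.inl i) + u (Sum.inr i) - 1 ≤ z i) :
    Matrix.PosSemidef (Matrix.of fun i j : Option (Fin n ⊕ Fin n) =>
      i.elim (j.elim (1 : ℝ) u) fun k => j.elim (u k)
        (pairedMoment (fun i => u (Sum.inl i)) (fun i => u (Sum.inr i)) z k)) := by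
  refine Matrix.PosSemidef.of_dotProduct_mulVec_nonneg ?_ fun v => ?_
  · ext i j
    rcases i with _ | i | i <;> rcases j with _ | j | j <;>
      simp only [Matrix.conjTranspose_apply, Matrix.of_apply, star_trivial, pairedMoment,
        Option.elim] <;>
      rcases eq_or_ne i j with rfl | h <;> simp [*, Ne.symm, mul_comm]
  · have hvar := Finset.sum_nonneg fun i (_ : i ∈ Finset.univ) =>
      variance_pair_nonneg (hz i) (hx i) (hy i) (hxy i) (v (some (Sum.inl i)))
        (v (some (Sum.inr i)))
    have hsq := sq_nonneg (v none + ∑ i, u (Sum.inl i) * v (some (Sum.inl i))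
      + ∑ i, u (Sum.inr i) * v (some (Sum.inr i)))
    refine (add_nonneg hsq hvar).trans_eq ?_
    simp only [dotProduct, Matrix.mulVec, Matrix.of_apply, Fintype.sum_option,
      Fintype.sum_sum_type, star_trivial, Pi.star_apply, pairedMoment, mul_add,
      Option.elim, Finset.sum_add_distrib]
    simp only [sum_mul_add_ite]
    have e₁ : ∀ g h : Fin n → ℝ, ∑ i, h i * (g i * v none) = (∑ i, g i * h i) * v none :=
      fun g h => by rw [Finset.sum_mul]; exact Finset.sum_congr rfl fun i _ => by ring
    have e₂ : ∀ c s t : Fin n → ℝ,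
        ∑ i, 2 * c i * (s i * t i) = ∑ i, c i * (s i * t i) + ∑ i, c i * (t i * s i) :=
      fun c s t => by
        rw [← Finset.sum_add_distrib]; exact Finset.sum_congr rfl fun i _ => by ring
    rw [e₁ (fun i => u (Sum.inl i)), e₁ (fun i => u (Sum.inr i)),
      e₂ (fun i => z i - u (Sum.inl i) * u (Sum.inr i))]
    ring

lemma mcCormick_mul {p q : ℝ} (hp : p ∈ Set.Icc (0 : ℝ) 1) (hq : q ∈ Set.Icc (0 : ℝ) 1) :
    max (p + q - 1) 0 ≤ p * q ∧ p * q ≤ min p q := by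
  obtain ⟨hp₀, hp₁⟩ := hp
  obtain ⟨hq₀, hq₁⟩ := hq
  exact ⟨max_le (by nlinarith) (by positivity), le_min (by nlinarith) (by nlinarith)⟩

lemma mcCormick_self {p : ℝ} (hp : p ∈ Set.Icc (0 : ℝ) 1) :
    max (p + p - 1) 0 ≤ p ∧ p ≤ min p p :=
  ⟨max_le (by linarith [hp.2]) hp.1, le_min le_rfl le_rfl⟩

lemma mcCormick_pairedMoment {n : ℕ} (u : Fin n ⊕ Fin n → ℝ) (z : Fin n → ℝ)
    (hu : ∀ i, u i ∈ Set.Icc (0 : ℝ) 1)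
    (hz : ∀ i, max (u (Sum.inl i) + u (Sum.inr i) - 1) 0 ≤ z i ∧
      z i ≤ min (u (Sum.inl i)) (u (Sum.inr i))) (k l : Fin n ⊕ Fin n) :
    max (u k + u l - 1) 0 ≤
        pairedMoment (fun i => u (Sum.inl i)) (fun i => u (Sum.inr i)) z k l ∧
      pairedMoment (fun i => u (Sum.inl i)) (fun i => u (Sum.inr i)) z k l ≤
        min (u k) (u l) := by
  rcases k with i | i <;> rcases l with j | j <;> rcases eq_or_ne i j with rfl | h <;>
    simp only [pairedMoment, if_true, add_sub_cancel, ne_eq] at * <;>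
    try simp only [h, if_false, add_zero]
  · exact mcCormick_self (hu _)
  · exact mcCormick_mul (hu _) (hu _)
  · exact hz i
  · exact mcCormick_mul (hu _) (hu _)
  · rw [mul_comm, add_sub_cancel, add_comm (u (Sum.inr i)), min_comm]
    exact hz i
  · exact mcCormick_mul (hu _) (hu _)
  · exact mcCormick_self (hu _)
  · exact mcCormick_mul (hu _) (hu _)


/-- The McCormick relaxation and the McCormick+SDP relaxation of a
separable QCQP are simultaneously (in)feasible and have the same optimal value.
Indices [2n] are encoded as `Fin n ⊕ Fin n` (i ↦ `Sum.inl i`, n+i ↦ `Sum.inr i`)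
and the extra index 0 of the moment matrix as `none` in `Option (Fin n ⊕ Fin n)`. -/
theorem stmt_12 (n m : ℕ) (hn : 1 ≤ n)
    (a0 cx0 cy0 : Fin n → ℝ)
    (a cx cy : Fin m → Fin n → ℝ) (b : Fin m → ℝ)
    (FMc FMS : Set ((Fin n → ℝ) × (Fin n → ℝ) × (Fin n ⊕ Fin n → ℝ)
      × Matrix (Fin n ⊕ Fin n) (Fin n ⊕ Fin n) ℝ))
    (f : ((Fin n → ℝ) × (Fin n → ℝ) × (Fin n ⊕ Fin n → ℝ)
      × Matrix (Fin n ⊕ Fin n) (Fin n ⊕ Fin n) ℝ) → ℝ)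
    (hFMc : FMc = {p | (∀ i, p.1 i = p.2.2.1 (Sum.inl i)) ∧
      (∀ i, p.2.1 i = p.2.2.1 (Sum.inr i)) ∧
      (∀ i, p.2.2.1 i ∈ Set.Icc (0 : ℝ) 1) ∧
      (∀ i k, max (p.2.2.1 i + p.2.2.1 k - 1) 0 ≤ p.2.2.2 i k ∧
        p.2.2.2 i k ≤ min (p.2.2.1 i) (p.2.2.1 k)) ∧
      (∀ j, b j ≤ ∑ i, a j i * p.2.2.2 (Sum.inl i) (Sum.inr i)
                  + ∑ i, cx j i * p.1 i + ∑ i, cy j i * p.2.1 i)})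
    (hFMS : FMS = {p | p ∈ FMc ∧
      Matrix.PosSemidef (Matrix.of fun i j : Option (Fin n ⊕ Fin n) =>
        match i, j with
        | none, none => (1 : ℝ)
        | none, some l => p.2.2.1 l
        | some k, none => p.2.2.1 k
        | some k, some l => p.2.2.2 k l)})
    (hf : f = fun p => ∑ i, a0 i * p.2.2.2 (Sum.inl i) (Sum.inr i)
                  + ∑ i, cx0 i * p.1 i + ∑ i, cy0 i * p.2.1 i) :
    (FMc.Nonempty ↔ FMS.Nonempty) ∧ sInf (f '' FMc) = sInf (f '' FMS) := by
  have hsub : FMS ⊆ FMc := by rw [hFMS]; exact fun p hp => hp.1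
  have hlift : ∀ p ∈ FMc, ∃ q ∈ FMS, f q = f p := by
    rintro ⟨x, y, u, w⟩ hp
    have hp' := hp
    rw [hFMc] at hp'
    obtain ⟨hx, hy, hu, hw, hb⟩ := hp'
    dsimp only at hx hy hu hw hb
    set w' := pairedMoment (fun i => u (Sum.inl i)) (fun i => u (Sum.inr i))
      (fun i => w (Sum.inl i) (Sum.inr i)) with hw'
    have hdiag : ∀ i, w' (Sum.inl i) (Sum.inr i) = w (Sum.inl i) (Sum.inr i) := fun i => by
      simp [hw', pairedMoment]
    refine ⟨(x, y, u, w'), ?_, by simp only [hf, hdiag]⟩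
    rw [hFMS]
    refine ⟨?_, ?psd⟩
    case psd =>
      convert posSemidef_pairedMoment u (fun i => w (Sum.inl i) (Sum.inr i))
        (fun i => (le_max_right _ _).trans (hw _ _).1)
        (fun i => (hw _ _).2.trans (min_le_left _ _))
        (fun i => (hw _ _).2.trans (min_le_right _ _))
        (fun i => (le_max_left _ _).trans (hw _ _).1) using 1
      ext (_ | i) (_ | j) <;> rfl
    · rw [hFMc]
      refine ⟨hx, hy, hu, mcCormick_pairedMoment u _ hu fun i => hw _ _, ?_⟩
      simpa only [hdiag] using hb
  refine ⟨⟨fun ⟨p, hp⟩ => ?_, fun h => h.mono hsub⟩, ?_⟩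
  · obtain ⟨q, hq, -⟩ := hlift p hp
    exact ⟨q, hq⟩
  · congr 1
    refine Set.Subset.antisymm ?_ (Set.image_mono hsub)
    rintro _ ⟨p, hp, rfl⟩
    exact hlift p hp
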